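/- Let q be odd. Let M and N be invertible 2×2 matrices over F such that det(M)·det(N) is a square in F, and such that the induced maps f, g ∈ 𝕄 of M and N are distinct. Let s be the number of points x ∈ ℙ¹ with f(x) = g(x) (so s ∈ {0,1,2}). Then the number of h ∈ 𝕄 such that h agrees with f at exactly one point of ℙ¹ and h agrees with g at exactly one point of ℙ¹ equals 2(q+1) if s = 0, and equals 2(q−1) if s ∈ {1,2}. -/

import Mathlib

noncomputable section

/-- The map `ℙ¹ → ℙ¹` induced by an invertible 2×2 matrix `M` over `F`,
sending the class of `v` to the class of `M v`. -/
def indMap {F : Type} [Field F] (M : GL (Fin 2) F) :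
    Projectivization F (Fin 2 → F) → Projectivization F (Fin 2 → F) :=
  Projectivization.map
    ((Matrix.GeneralLinearGroup.toLin M).toLinearEquiv : (Fin 2 → F) →ₗ[F] (Fin 2 → F))
    (Matrix.GeneralLinearGroup.toLin M).toLinearEquiv.injective

/-- The set `𝕄` of all maps `ℙ¹ → ℙ¹` induced by invertible 2×2 matrices over `F`,
i.e. the elements of `PGL(2,q)` acting on the projective line. -/
def pglMaps (F : Type) [Field F] :
    Set (Projectivization F (Fin 2 → F) → Projectivization F (Fin 2 → F)) :=
  Set.range indMap

open Matrix

section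

variable {F : Type} [Field F]

theorem indMap_mk (A : GL (Fin 2) F) (v : Fin 2 → F) (hv : v ≠ 0) :
    ∃ h, indMap A (Projectivization.mk F v hv) =
      Projectivization.mk F ((A : Matrix (Fin 2) (Fin 2) F) *ᵥ v) h := by
  refine ⟨?_, ?_⟩
  · intro h
    apply hv
    have := congrArg (fun w => ((A⁻¹ : GL (Fin 2) F) : Matrix (Fin 2) (Fin 2) F) *ᵥ w) h
    simpa only [Matrix.mulVec_mulVec, ← Units.val_mul, inv_mul_cancel, Units.val_one,
      Matrix.one_mulVec, Matrix.mulVec_zero] using this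
  · rfl

theorem mk_eq_mk_iff_cross (v w : Fin 2 → F) (hv : v ≠ 0) (hw : w ≠ 0) :
    Projectivization.mk F v hv = Projectivization.mk F w hw ↔ v 0 * w 1 = v 1 * w 0 := by
  rw [Projectivization.mk_eq_mk_iff']
  constructor
  · rintro ⟨a, rfl⟩
    simp only [Pi.smul_apply, smul_eq_mul]
    ring
  · intro h
    have hw' : w 0 ≠ 0 ∨ w 1 ≠ 0 := by
      by_contra! h0
      exact hw (by ext i; fin_cases i <;> simp [h0])
    rcases hw' with h0 | h0
    · refine ⟨v 0 / w 0, ?_⟩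
      ext i; fin_cases i <;> simp <;> field_simp
      linear_combination h
    · refine ⟨v 1 / w 1, ?_⟩
      ext i; fin_cases i <;> simp <;> field_simp
      linear_combination -h

/-- The binary quadratic form `v ∧ A v`, whose zeros are the eigenvectors of `A`. -/
def eigenForm (A : Matrix (Fin 2) (Fin 2) F) (v : Fin 2 → F) : F :=
  A 1 0 * v 0 ^ 2 + (A 1 1 - A 0 0) * v 0 * v 1 - A 0 1 * v 1 ^ 2

theorem indMap_mk_eq_self_iff (A : GL (Fin 2) F) (v : Fin 2 → F) (hv : v ≠ 0) :
    indMap A (Projectivization.mk F v hv) = Projectivization.mk F v hv ↔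
      eigenForm (A : Matrix (Fin 2) (Fin 2) F) v = 0 := by
  obtain ⟨h, e⟩ := indMap_mk A v hv
  rw [e, mk_eq_mk_iff_cross]
  simp only [Matrix.mulVec, dotProduct, Fin.sum_univ_two, eigenForm]
  constructor <;> intro h <;> linear_combination -h

theorem indMap_mul (A B : GL (Fin 2) F) (x : Projectivization F (Fin 2 → F)) :
    indMap (A * B) x = indMap A (indMap B x) := by
  induction x using Projectivization.ind with
  | h v hv =>
    obtain ⟨_, e⟩ := indMap_mk B v hv
    obtain ⟨_, e'⟩ := indMap_mk (A * B) v hv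
    rw [e, e']
    obtain ⟨_, e''⟩ := indMap_mk A ((B : Matrix (Fin 2) (Fin 2) F) *ᵥ v) (by assumption)
    rw [e'']
    simp only [Units.val_mul, Matrix.mulVec_mulVec]

theorem indMap_injective (A : GL (Fin 2) F) : Function.Injective (indMap A) :=
  Projectivization.map_injective _ _

theorem indMap_eq_of_smul {A B : GL (Fin 2) F} {c : F}
    (h : (A : Matrix (Fin 2) (Fin 2) F) = c • (B : Matrix (Fin 2) (Fin 2) F)) :
    indMap A = indMap B := by
  funext x
  induction x using Projectivization.ind with
  | h v hv =>
    obtain ⟨_, e⟩ := indMap_mk A v hv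
    obtain ⟨_, e'⟩ := indMap_mk B v hv
    rw [e, e', mk_eq_mk_iff_cross, h]
    simp only [Matrix.smul_mulVec, Pi.smul_apply, smul_eq_mul]
    ring

theorem vec_ne_zero {x y : F} (h : x ≠ 0 ∨ y ≠ 0) : (![x, y] : Fin 2 → F) ≠ 0 := by
  intro h0
  have h1 := congrFun h0 0
  have h2 := congrFun h0 1
  simp_all

/-- A matrix all of whose nonzero vectors are eigenvectors is scalar. -/
theorem eq_smul_one_of_forall_indMap {A : GL (Fin 2) F} (h : ∀ x, indMap A x = x) :
    ∃ c : F, (A : Matrix (Fin 2) (Fin 2) F) = c • 1 := by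
  have h1 := (indMap_mk_eq_self_iff A ![1, 0] (vec_ne_zero (by simp))).1 (h _)
  have h2 := (indMap_mk_eq_self_iff A ![0, 1] (vec_ne_zero (by simp))).1 (h _)
  have h3 := (indMap_mk_eq_self_iff A ![1, 1] (vec_ne_zero (by simp))).1 (h _)
  simp [eigenForm] at h1 h2 h3
  refine ⟨(A : Matrix (Fin 2) (Fin 2) F) 0 0, ?_⟩
  ext i j
  fin_cases i <;> fin_cases j <;> simp [h1, h2]
  linear_combination h3 - h1 + h2

theorem existsUnique_fixed_iff (h2 : (2 : F) ≠ 0) (A : GL (Fin 2) F) :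
    (∃! x, indMap A x = x) ↔
      (A : Matrix (Fin 2) (Fin 2) F).trace ^ 2 = 4 * (A : Matrix (Fin 2) (Fin 2) F).det ∧
        ∀ c : F, (A : Matrix (Fin 2) (Fin 2) F) ≠ c • 1 := by
  set B := (A : Matrix (Fin 2) (Fin 2) F) with hB
  have key : ∀ x y : F, ∀ h : x ≠ 0 ∨ y ≠ 0,
      (indMap A (Projectivization.mk F ![x, y] (vec_ne_zero h)) =
        Projectivization.mk F ![x, y] (vec_ne_zero h) ↔
        B 1 0 * x ^ 2 + (B 1 1 - B 0 0) * x * y - B 0 1 * y ^ 2 = 0) := by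
    intro x y h
    rw [indMap_mk_eq_self_iff]
    simp [eigenForm, hB]
  have hsurj : ∀ p : Projectivization F (Fin 2 → F), ∃ x y : F, ∃ h : x ≠ 0 ∨ y ≠ 0,
      p = Projectivization.mk F ![x, y] (vec_ne_zero h) := by
    intro p
    induction p using Projectivization.ind with
    | h v hv =>
      have hv' : v 0 ≠ 0 ∨ v 1 ≠ 0 := by
        by_contra! h0
        exact hv (by ext i; fin_cases i <;> simp [h0])
      exact ⟨v 0, v 1, hv', by rw [mk_eq_mk_iff_cross]; simp [mul_comm]⟩
  have hcross : ∀ x y z w : F, ∀ h : x ≠ 0 ∨ y ≠ 0, ∀ h' : z ≠ 0 ∨ w ≠ 0,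
      (Projectivization.mk F ![x, y] (vec_ne_zero h) =
        Projectivization.mk F ![z, w] (vec_ne_zero h') ↔ x * w = y * z) := by
    intro x y z w h h'
    rw [mk_eq_mk_iff_cross]; simp
  have hsc : (∀ c : F, B ≠ c • 1) ↔ ¬ (B 1 0 = 0 ∧ B 0 1 = 0 ∧ B 1 1 = B 0 0) := by
    rw [← not_exists, not_iff_not]
    constructor
    · rintro ⟨c, hc⟩; simp [hc]
    · rintro ⟨h1, h2, h3⟩
      refine ⟨B 0 0, ?_⟩
      ext i j
      fin_cases i <;> fin_cases j <;> simp [h1, h2, h3]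
  rw [hsc, Matrix.trace_fin_two, Matrix.det_fin_two]
  generalize B 0 0 = a at *
  generalize B 0 1 = b at *
  generalize B 1 0 = c at *
  generalize B 1 1 = d at *
  constructor
  · rintro ⟨p, hp, hu⟩
    obtain ⟨x, y, h, rfl⟩ := hsurj p
    simp only at hp hu
    replace hp := (key x y h).1 hp
    have hu' : ∀ z w : F, (z ≠ 0 ∨ w ≠ 0) →
        c * z ^ 2 + (d - a) * z * w - b * w ^ 2 = 0 → z * y = w * x := by
      intro z w h' hz
      rw [← hcross z w x y h' h]
      exact hu _ ((key z w h').2 hz)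
    have hns : ¬ (c = 0 ∧ b = 0 ∧ d = a) := by
      rintro ⟨rfl, rfl, rfl⟩
      have h1 := hu' 1 0 (by simp) (by ring)
      have h3 := hu' 0 1 (by simp) (by ring)
      simp at h1 h3
      rcases h with h | h
      · exact h h3.symm
      · exact h h1
    refine ⟨?_, hns⟩
    by_cases hx : x = 0
    · subst hx
      have hy : y ≠ 0 := by simpa using h
      have hb : b = 0 := by
        have : b * y ^ 2 = 0 := by linear_combination -hp
        simpa [hy] using this
      subst hb
      by_cases hda : d = a
      · subst hda; ring
      · have := hu' (a - d) c (.inl (sub_ne_zero.2 (Ne.symm hda))) (by ring)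
        have : (a - d) * y = 0 := by linear_combination this
        simp [hy, sub_eq_zero, Ne.symm hda] at this
    · by_cases hz : b * y = 0 ∧ b * x = 0
      · have hb : b = 0 := by simpa [hx] using hz.2
        subst hb
        have := hu' 0 1 (by simp) (by ring)
        simp at this
        exact absurd this.symm hx
      · -- the conjugate root `(b x : (d - a) x - b y)`
        have hne : b * x ≠ 0 ∨ (d - a) * x - b * y ≠ 0 := by
          by_contra! h0
          have hb : b = 0 := by simpa [hx] using h0.1
          exact hz (by simp [hb])
        have := hu' (b * x) ((d - a) * x - b * y) hne (by linear_combination b ^ 2 * hp)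
        have h4 : x * (2 * b * y - (d - a) * x) = 0 := by linear_combination this
        have h5 : 2 * b * y - (d - a) * x = 0 := by simpa [hx] using h4
        have h6 : x ^ 2 * ((a + d) ^ 2 - 4 * (a * d - b * c)) = 0 := by
          linear_combination 4 * b * hp + (2 * b * y - (d - a) * x) * h5
        have h7 : (a + d) ^ 2 - 4 * (a * d - b * c) = 0 := by simpa [hx] using h6
        linear_combination h7
  · rintro ⟨hd, hns⟩
    have hd' : (d - a) ^ 2 + 4 * b * c = 0 := by linear_combination hd
    by_cases hc : c = 0
    · subst hc
      have hda : d = a := by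
        have : (d - a) ^ 2 = 0 := by linear_combination hd'
        simpa [sub_eq_zero] using this
      subst hda
      have hb : b ≠ 0 := by simpa using hns
      refine ⟨Projectivization.mk F ![1, 0] (vec_ne_zero (by simp)),
        (key _ _ (by simp)).2 (by ring), ?_⟩
      intro p hp
      obtain ⟨x, y, h, rfl⟩ := hsurj p
      replace hp := (key x y h).1 hp
      have : b * y ^ 2 = 0 := by linear_combination -hp
      refine (hcross _ _ _ _ h (by simp)).2 ?_
      have hy : y = 0 := by simpa [hb] using this
      simp [hy]
    · have h2c : 2 * c ≠ 0 := mul_ne_zero h2 hc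
      refine ⟨Projectivization.mk F ![a - d, 2 * c] (vec_ne_zero (.inr h2c)),
        (key _ _ (.inr h2c)).2 (by linear_combination -c * hd'), ?_⟩
      intro p hp
      obtain ⟨x, y, h, rfl⟩ := hsurj p
      replace hp := (key x y h).1 hp
      refine (hcross _ _ _ _ h (.inr h2c)).2 ?_
      have : (2 * c * x + (d - a) * y) ^ 2 = 0 := by
        linear_combination 4 * c * hp + y ^ 2 * hd'
      have := pow_eq_zero_iff (two_ne_zero) |>.1 this
      linear_combination this

/-- The matrix `1 + c • v (J v)ᵀ` of determinant `1` and trace `2`, fixing `v`. -/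
def unipotent (v : Fin 2 → F) (c : F) : SpecialLinearGroup (Fin 2) F :=
  ⟨!![1 - c * v 0 * v 1, c * v 0 ^ 2; -c * v 1 ^ 2, 1 + c * v 0 * v 1], by
    rw [Matrix.det_fin_two_of]; ring⟩

theorem trace_unipotent (v : Fin 2 → F) (c : F) : (unipotent v c).1.trace = 2 := by
  simp [unipotent, Matrix.trace_fin_two]; ring

theorem trace_mul_unipotent (W : Matrix (Fin 2) (Fin 2) F) (v : Fin 2 → F) (c : F) :
    (W * (unipotent v c).1).trace = W.trace + c * eigenForm W v := by
  simp [unipotent, Matrix.trace_fin_two, Matrix.mul_apply, eigenForm]; ring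

theorem unipotent_mul (v : Fin 2 → F) (c d : F) :
    unipotent v c * unipotent v d = unipotent v (c + d) := by
  apply Subtype.ext
  change (unipotent v c).1 * (unipotent v d).1 = _
  ext i j
  fin_cases i <;> fin_cases j <;> simp [unipotent] <;> ring

theorem unipotent_zero (v : Fin 2 → F) : unipotent v 0 = 1 := by
  ext i j
  fin_cases i <;> fin_cases j <;> simp [unipotent]

theorem unipotent_smul (v : Fin 2 → F) (a c : F) :
    unipotent (a • v) c = unipotent v (a ^ 2 * c) := by
  ext i j
  fin_cases i <;> fin_cases j <;> simp [unipotent] <;> ring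

theorem eigenForm_smul (A : Matrix (Fin 2) (Fin 2) F) (a : F) (v : Fin 2 → F) :
    eigenForm A (a • v) = a ^ 2 * eigenForm A v := by
  simp [eigenForm]; ring

theorem unipotent_entries {v w : Fin 2 → F} {c d : F} (h : unipotent v c = unipotent w d) :
    c * v 0 * v 1 = d * w 0 * w 1 ∧ c * v 0 ^ 2 = d * w 0 ^ 2 ∧ c * v 1 ^ 2 = d * w 1 ^ 2 := by
  have h00 := congrArg (fun U : SpecialLinearGroup (Fin 2) F => U.1 0 0) h
  have h01 := congrArg (fun U : SpecialLinearGroup (Fin 2) F => U.1 0 1) h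
  have h10 := congrArg (fun U : SpecialLinearGroup (Fin 2) F => U.1 1 0) h
  simp only [unipotent, Matrix.of_apply, Matrix.cons_val', Matrix.cons_val_zero,
    Matrix.cons_val_one, Matrix.cons_val_fin_one] at h00 h01 h10
  exact ⟨by linear_combination -h00, h01, by linear_combination -h10⟩

theorem unipotent_injective {v : Fin 2 → F} (hv : v ≠ 0) : Function.Injective (unipotent v) := by
  intro c d h
  obtain ⟨-, h0, h1⟩ := unipotent_entries h
  by_cases hv0 : v 0 = 0
  · have hv1 : v 1 ≠ 0 := fun h1 => hv (by ext i; fin_cases i <;> simp [hv0, h1])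
    exact mul_right_cancel₀ (pow_ne_zero 2 hv1) h1
  · exact mul_right_cancel₀ (pow_ne_zero 2 hv0) h0

theorem cross_eq_of_unipotent_eq {v w : Fin 2 → F} {c d : F} (hc : c ≠ 0)
    (h : unipotent v c = unipotent w d) : v 0 * w 1 = v 1 * w 0 := by
  obtain ⟨h01, h00, h11⟩ := unipotent_entries h
  have : c * (v 0 * w 1 - v 1 * w 0) ^ 2 = 0 := by
    linear_combination w 1 ^ 2 * h00 - 2 * w 0 * w 1 * h01 + w 0 ^ 2 * h11
  simpa [hc, sub_eq_zero] using this

theorem exists_eq_unipotent (U : SpecialLinearGroup (Fin 2) F) (hU : U.1.trace = 2) :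
    ∃ v : Fin 2 → F, ∃ c : F, v ≠ 0 ∧ U = unipotent v c := by
  have hd := U.2
  rw [Matrix.det_fin_two] at hd
  rw [Matrix.trace_fin_two] at hU
  by_cases hb : U.1 0 1 = 0
  · have h1 : (U.1 0 0 - 1) ^ 2 = 0 := by
      linear_combination U.1 0 0 * hU - hd - U.1 1 0 * hb
    have h0 : U.1 0 0 = 1 := by simpa [sub_eq_zero] using h1
    refine ⟨![0, 1], -U.1 1 0, vec_ne_zero (by simp), ?_⟩
    ext i j
    fin_cases i <;> fin_cases j <;> simp [unipotent, h0, hb]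
    linear_combination hU - h0
  · refine ⟨![U.1 0 1, 1 - U.1 0 0], (U.1 0 1)⁻¹, vec_ne_zero (.inl hb), ?_⟩
    ext i j
    fin_cases i <;> fin_cases j <;> simp [unipotent] <;> field_simp
    · ring
    · linear_combination -hd + U.1 0 0 * hU
    · linear_combination hU

theorem ncard_trace_mul_eq (W : SpecialLinearGroup (Fin 2) F) (k : F) (hk : W.1.trace ≠ k) :
    {U : SpecialLinearGroup (Fin 2) F | U.1.trace = 2 ∧ (W.1 * U.1).trace = k}.ncard =
      {x | indMap (W : GL (Fin 2) F) x ≠ x}.ncard := by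
  have hQ : ∀ x, indMap (W : GL (Fin 2) F) x ≠ x ↔ eigenForm W.1 x.rep ≠ 0 := by
    intro x
    rw [not_iff_not, ← SpecialLinearGroup.coe_GL_coe_matrix,
      ← indMap_mk_eq_self_iff _ _ x.rep_nonzero, x.mk_rep]
  symm
  refine Set.ncard_congr (fun x _ => unipotent x.rep ((k - W.1.trace) / eigenForm W.1 x.rep))
    ?_ ?_ ?_
  · intro x hx
    have hx' := (hQ x).1 hx
    refine ⟨trace_unipotent _ _, ?_⟩
    rw [trace_mul_unipotent]
    field_simp
    ring
  · intro x y hx hy h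
    rw [← x.mk_rep, ← y.mk_rep, mk_eq_mk_iff_cross]
    exact cross_eq_of_unipotent_eq (div_ne_zero (sub_ne_zero.2 hk.symm) ((hQ x).1 hx)) h
  · rintro U ⟨hU, hWU⟩
    obtain ⟨v, c, hv, rfl⟩ := exists_eq_unipotent U hU
    rw [trace_mul_unipotent] at hWU
    have hc : c * eigenForm W.1 v ≠ 0 := fun h => hk (by rw [← hWU, h, add_zero])
    have hv' := right_ne_zero_of_mul hc
    obtain ⟨a, ha⟩ := Projectivization.exists_smul_eq_mk_rep F v hv
    have ha' : (Projectivization.mk F v hv).rep = (a : F) • v := ha.symm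
    have ha0 : (a : F) ≠ 0 := a.ne_zero
    refine ⟨Projectivization.mk F v hv, ?_, ?_⟩
    · refine (hQ _).2 ?_
      rw [ha', eigenForm_smul]
      exact mul_ne_zero (pow_ne_zero 2 ha0) hv'
    · rw [ha', eigenForm_smul, unipotent_smul, ← hWU]
      congr 1
      field_simp
      ring

theorem smul_one_trace (c : F) : (c • (1 : Matrix (Fin 2) (Fin 2) F)).trace = 2 * c := by
  simp [mul_comm]

/-- Scalar matrices of determinant one have square one. -/
theorem sq_eq_one_of_eq_smul_one {U : SpecialLinearGroup (Fin 2) F} {c : F}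
    (h : U.1 = c • 1) : c ^ 2 = 1 := by
  have := U.2
  rw [h, Matrix.det_fin_two] at this
  simp at this
  linear_combination this

theorem trace_eq_of_mul_eq_smul_one {W U : SpecialLinearGroup (Fin 2) F} {c : F}
    (h : W.1 * U.1 = c • 1) : W.1.trace = c * U.1.trace := by
  have hW : W.1 = c • (U⁻¹).1 := by
    have := congrArg (fun A => A * (U⁻¹).1) h
    simp only [Matrix.smul_mul, one_mul, mul_assoc] at this
    rw [← this]
    change W.1 = (W * (U * U⁻¹)).1
    simp
  rw [hW, Matrix.trace_smul, SpecialLinearGroup.SL2_inv_expl, smul_eq_mul]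
  rw [Matrix.trace_fin_two U.1, add_comm]
  exact congrArg (c * ·) (Matrix.trace_fin_two _)

theorem ncard_trace_mul_eq_of_parabolic [Fintype F] (W : SpecialLinearGroup (Fin 2) F) (e : F)
    (h2 : (2 : F) ≠ 0) (he : e ^ 2 = 1) (hW : W.1.trace = 2 * e) (hns : ∀ c : F, W.1 ≠ c • 1) :
    {U : SpecialLinearGroup (Fin 2) F | U.1.trace = 2 ∧ U ≠ 1 ∧ (W.1 * U.1).trace = 2 * e ∧
      ∀ c : F, W.1 * U.1 ≠ c • 1}.ncard = Fintype.card F - 2 := by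
  have he0 : e ≠ 0 := by rintro rfl; simp at he
  obtain ⟨v, d, hv, hW'⟩ : ∃ v : Fin 2 → F, ∃ d : F, v ≠ 0 ∧ W.1 = e • (unipotent v d).1 := by
    obtain ⟨v, d, hv, h⟩ := exists_eq_unipotent ⟨e • W.1, by
      rw [Matrix.det_smul, W.2]; simpa using he⟩ (by
      rw [Matrix.trace_smul, hW, smul_eq_mul]; linear_combination 2 * he)
    refine ⟨v, d, hv, ?_⟩
    rw [← h, smul_smul, ← sq, he, one_smul]
  have hd : d ≠ 0 := by
    rintro rfl
    exact hns e (by rw [hW', unipotent_zero]; rfl)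
  have hmul : ∀ c, W.1 * (unipotent v c).1 = e • (unipotent v (d + c)).1 := by
    intro c
    rw [hW', ← unipotent_mul, Matrix.smul_mul]; rfl
  have hcard : ({0, -d}ᶜ : Set F).ncard = Fintype.card F - 2 := by
    rw [Set.ncard_compl, Set.ncard_pair (by simpa using hd), Nat.card_eq_fintype_card]
  rw [← hcard]
  symm
  refine Set.ncard_congr (fun c _ => unipotent v c) ?_ ?_ ?_
  · intro c hc
    simp only [Set.mem_compl_iff, Set.mem_insert_iff, Set.mem_singleton_iff, not_or] at hc
    refine ⟨trace_unipotent _ _, ?_, ?_, ?_⟩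
    · rw [← unipotent_zero v]
      exact fun h => hc.1 (unipotent_injective hv h)
    · rw [hmul, Matrix.trace_smul, trace_unipotent, smul_eq_mul, mul_comm]
    · intro a ha
      rw [hmul] at ha
      have ht := congrArg Matrix.trace ha
      rw [Matrix.trace_smul, trace_unipotent, smul_one_trace, smul_eq_mul, mul_comm] at ht
      rw [← mul_left_cancel₀ h2 ht] at ha
      have h1 : unipotent v (d + c) = unipotent v 0 := by
        rw [unipotent_zero]
        exact Subtype.ext (smul_right_injective _ he0 ha)
      exact hc.2 (eq_neg_of_add_eq_zero_right (unipotent_injective hv h1))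
  · intro c c' _ _ h
    exact unipotent_injective hv h
  · rintro U ⟨hU, hU1, hWU, hWUs⟩
    obtain ⟨w, c, hw, rfl⟩ := exists_eq_unipotent U hU
    have hc : c ≠ 0 := by rintro rfl; exact hU1 (unipotent_zero w)
    rw [trace_mul_unipotent, hW] at hWU
    have hq : eigenForm W.1 w = 0 := by
      have : c * eigenForm W.1 w = 0 := by linear_combination hWU
      simpa [hc] using this
    have hcr : (w 0 * v 1 - w 1 * v 0) ^ 2 = 0 := by
      have : e * d * (w 0 * v 1 - w 1 * v 0) ^ 2 = 0 := by
        rw [hW'] at hq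
        simp [eigenForm, unipotent] at hq
        linear_combination -hq
      simpa [he0, hd] using this
    have hcr' : w 0 * v 1 = w 1 * v 0 := by simpa [sub_eq_zero] using hcr
    rw [← mk_eq_mk_iff_cross _ _ hw hv, Projectivization.mk_eq_mk_iff'] at hcr'
    obtain ⟨a, rfl⟩ := hcr'
    rw [unipotent_smul] at hU1 hWUs ⊢
    refine ⟨a ^ 2 * c, ?_, rfl⟩
    simp only [Set.mem_compl_iff, Set.mem_insert_iff, Set.mem_singleton_iff, not_or]
    refine ⟨fun h => hU1 (by rw [h, unipotent_zero]), fun h => hWUs e ?_⟩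
    rw [hmul, h, add_neg_cancel, unipotent_zero]; rfl

/-- Common unique-agreement neighbours correspond to unipotent matrices `U ≠ 1` such that `W U`
is parabolic. -/
theorem ncard_common_neighbours (h2 : (2 : F) ≠ 0) (M N : GL (Fin 2) F)
    (W : SpecialLinearGroup (Fin 2) F) (hW : indMap M = indMap (N * (W : GL (Fin 2) F))) :
    {h | h ∈ pglMaps F ∧ (∃! x, h x = indMap M x) ∧ (∃! x, h x = indMap N x)}.ncard =
      {U : SpecialLinearGroup (Fin 2) F | U.1.trace = 2 ∧ U ≠ 1 ∧
        (W.1 * U.1).trace ^ 2 = 4 ∧ ∀ c : F, W.1 * U.1 ≠ c • 1}.ncard := by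
  have hM : ∀ (U : GL (Fin 2) F) x, indMap (M * U) x = indMap M x ↔ indMap U x = x := by
    intro U x
    rw [indMap_mul, (indMap_injective M).eq_iff]
  have hN : ∀ (U : GL (Fin 2) F) x, indMap (M * U) x = indMap N x ↔
      indMap ((W : GL (Fin 2) F) * U) x = x := by
    intro U x
    rw [indMap_mul, hW, indMap_mul, (indMap_injective N).eq_iff, indMap_mul]
  have hWU : ∀ U : SpecialLinearGroup (Fin 2) F,
      (∃! x, indMap ((W : GL (Fin 2) F) * (U : GL (Fin 2) F)) x = x) ↔
      (W.1 * U.1).trace ^ 2 = 4 ∧ ∀ c : F, W.1 * U.1 ≠ c • 1 := by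
    intro U
    rw [existsUnique_fixed_iff h2]
    simp only [Units.val_mul, SpecialLinearGroup.coe_GL_coe_matrix, Matrix.det_mul]
    rw [W.2, U.2, mul_one, mul_one]
  symm
  refine Set.ncard_congr (fun U _ => indMap (M * (U : GL (Fin 2) F))) ?_ ?_ ?_
  · rintro U ⟨hU, hU1, hUW⟩
    refine ⟨⟨_, rfl⟩, ?_, ?_⟩
    · simp only [hM]
      rw [existsUnique_fixed_iff h2, SpecialLinearGroup.coe_GL_coe_matrix, U.2]
      refine ⟨by rw [hU]; norm_num, fun c hc => hU1 ?_⟩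
      have ht := congrArg Matrix.trace hc
      rw [hU, smul_one_trace] at ht
      have hc1 : c = 1 := mul_left_cancel₀ h2 (by rw [← ht, mul_one])
      rw [hc1, one_smul] at hc
      exact Subtype.ext hc
    · simp only [hN]
      exact (hWU U).2 hUW
  · rintro U V ⟨hU, -⟩ ⟨hV, -⟩ h
    have h1 : ∀ x, indMap ((V : GL (Fin 2) F)⁻¹ * (U : GL (Fin 2) F)) x = x := by
      intro x
      have hx := congrFun h x
      simp only [indMap_mul, (indMap_injective M).eq_iff] at hx
      apply indMap_injective (V : GL (Fin 2) F)
      rw [← indMap_mul, mul_inv_cancel_left, hx]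
    obtain ⟨c, hc⟩ := eq_smul_one_of_forall_indMap h1
    have hUV : U.1 = c • V.1 := by
      have := congrArg (fun A => V.1 * A) hc
      simp only [Matrix.mul_smul, mul_one] at this
      rw [← this]
      change U.1 = ((V : GL (Fin 2) F) * ((V : GL (Fin 2) F)⁻¹ * (U : GL (Fin 2) F)) :
        GL (Fin 2) F).1
      rw [mul_inv_cancel_left]; rfl
    have ht := congrArg Matrix.trace hUV
    rw [Matrix.trace_smul, hU, hV, smul_eq_mul] at ht
    have hc1 : c = 1 := mul_right_cancel₀ h2 (by rw [← ht, one_mul])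
    exact Subtype.ext (by rw [hUV, hc1, one_smul])
  · rintro h ⟨⟨H, rfl⟩, h1, h3⟩
    obtain ⟨K, rfl⟩ : ∃ K, H = M * K := ⟨M⁻¹ * H, by simp⟩
    have h1' := h1
    simp only [hM] at h1'
    obtain ⟨htr, hs⟩ := (existsUnique_fixed_iff h2 K).1 h1'
    have hdet : K.1.det ≠ 0 := ((Matrix.isUnit_iff_isUnit_det _).1 K.isUnit).ne_zero
    have ht0 : K.1.trace ≠ 0 := by
      intro h0
      rw [h0] at htr
      have : (2 : F) * 2 * K.1.det = 0 := by linear_combination -htr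
      simp [h2, hdet] at this
    let U : SpecialLinearGroup (Fin 2) F := ⟨(2 / K.1.trace) • K.1, by
      rw [Matrix.det_smul, Fintype.card_fin]
      field_simp
      linear_combination -htr⟩
    have hUt : U.1.trace = 2 := by
      simp only [U, Matrix.trace_smul, smul_eq_mul]
      field_simp
    have hMU : indMap (M * (U : GL (Fin 2) F)) = indMap (M * K) := by
      apply indMap_eq_of_smul (c := 2 / K.1.trace)
      exact Matrix.mul_smul _ _ _
    refine ⟨U, ⟨hUt, ?_, (hWU U).1 ?_⟩, hMU⟩
    · intro hU1
      refine hs (K.1.trace / 2) ?_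
      have : (2 / K.1.trace) • K.1 = 1 := congrArg Subtype.val hU1
      rw [← this, smul_smul]
      field_simp
      simp
    · simp only [← hN, hMU]
      exact h3

theorem exists_specialLinear_quotient (M N : GL (Fin 2) F)
    (hdet : IsSquare ((M : Matrix (Fin 2) (Fin 2) F).det * (N : Matrix (Fin 2) (Fin 2) F).det)) :
    ∃ W : SpecialLinearGroup (Fin 2) F, indMap M = indMap (N * (W : GL (Fin 2) F)) := by
  obtain ⟨c, hc⟩ := hdet
  have hM : M.1.det ≠ 0 := ((Matrix.isUnit_iff_isUnit_det _).1 M.isUnit).ne_zero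
  have hN : N.1.det ≠ 0 := ((Matrix.isUnit_iff_isUnit_det _).1 N.isUnit).ne_zero
  have hc0 : c ≠ 0 := by
    rintro rfl
    simp [hM, hN] at hc
  refine ⟨⟨c⁻¹ • (N.1.adjugate * M.1), ?_⟩, ?_⟩
  · rw [Matrix.det_smul, Matrix.det_mul, Matrix.det_adjugate, Fintype.card_fin]
    field_simp
    linear_combination hc
  · symm
    apply indMap_eq_of_smul (c := c⁻¹ * N.1.det)
    change N.1 * (c⁻¹ • (N.1.adjugate * M.1)) = _
    rw [Matrix.mul_smul, ← mul_assoc, Matrix.mul_adjugate, Matrix.smul_mul, one_mul, smul_smul]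

theorem ncard_parabolic_of_trace_sq_ne [Fintype F] (h2 : (2 : F) ≠ 0)
    (W : SpecialLinearGroup (Fin 2) F) (hW : W.1.trace ^ 2 ≠ 4) :
    {U : SpecialLinearGroup (Fin 2) F | U.1.trace = 2 ∧ U ≠ 1 ∧
        (W.1 * U.1).trace ^ 2 = 4 ∧ ∀ c : F, W.1 * U.1 ≠ c • 1}.ncard =
      2 * {x | indMap (W : GL (Fin 2) F) x ≠ x}.ncard := by
  have hsplit : {U : SpecialLinearGroup (Fin 2) F | U.1.trace = 2 ∧ U ≠ 1 ∧
        (W.1 * U.1).trace ^ 2 = 4 ∧ ∀ c : F, W.1 * U.1 ≠ c • 1} =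
      {U | U.1.trace = 2 ∧ (W.1 * U.1).trace = 2} ∪
        {U | U.1.trace = 2 ∧ (W.1 * U.1).trace = -2} := by
    ext U
    have hsq : (W.1 * U.1).trace ^ 2 = 4 ↔ (W.1 * U.1).trace = 2 ∨ (W.1 * U.1).trace = -2 := by
      rw [← sq_eq_sq_iff_eq_or_eq_neg]; norm_num
    simp only [Set.mem_ofPred_eq, Set.mem_union, ← and_or_left, ← hsq]
    constructor
    · rintro ⟨h, -, h', -⟩
      exact ⟨h, h'⟩
    · rintro ⟨h, h'⟩
      refine ⟨h, ?_, h', ?_⟩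
      · rintro rfl
        exact hW (by simpa using h')
      · intro c hc
        have hc1 : c ^ 2 = 1 := sq_eq_one_of_eq_smul_one (U := W * U) hc
        apply hW
        rw [trace_eq_of_mul_eq_smul_one hc, h]
        linear_combination 4 * hc1
  have hne : (2 : F) ≠ -2 := by
    intro h
    have : (2 : F) * 2 = 0 := by linear_combination h
    simp [h2] at this
  rw [hsplit, Set.ncard_union_eq, ncard_trace_mul_eq, ncard_trace_mul_eq, two_mul]
  · rintro h; exact hW (by rw [h]; norm_num)
  · rintro h; exact hW (by rw [h]; norm_num)
  · rw [Set.disjoint_left]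
    rintro U ⟨-, h⟩ ⟨-, h'⟩
    exact hne (h.symm.trans h')

theorem ncard_parabolic_of_trace_sq_eq [Fintype F] (h2 : (2 : F) ≠ 0)
    (W : SpecialLinearGroup (Fin 2) F) (hW : W.1.trace ^ 2 = 4) (hns : ∀ c : F, W.1 ≠ c • 1) :
    {U : SpecialLinearGroup (Fin 2) F | U.1.trace = 2 ∧ U ≠ 1 ∧
        (W.1 * U.1).trace ^ 2 = 4 ∧ ∀ c : F, W.1 * U.1 ≠ c • 1}.ncard =
      Fintype.card F - 2 + {x | indMap (W : GL (Fin 2) F) x ≠ x}.ncard := by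
  obtain ⟨e, he, hWe⟩ : ∃ e : F, e ^ 2 = 1 ∧ W.1.trace = 2 * e := by
    refine ⟨W.1.trace / 2, ?_, by field_simp⟩
    rw [div_pow, hW]
    have : (4 : F) = 2 ^ 2 := by norm_num
    rw [this, div_self (pow_ne_zero 2 h2)]
  have he0 : e ≠ 0 := by rintro rfl; simp at he
  have hne : 2 * e ≠ -(2 * e) := by
    intro h
    have : (2 : F) * 2 * e = 0 := by linear_combination h
    simp [h2, he0] at this
  have hsplit : {U : SpecialLinearGroup (Fin 2) F | U.1.trace = 2 ∧ U ≠ 1 ∧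
        (W.1 * U.1).trace ^ 2 = 4 ∧ ∀ c : F, W.1 * U.1 ≠ c • 1} =
      {U | U.1.trace = 2 ∧ U ≠ 1 ∧ (W.1 * U.1).trace = 2 * e ∧ ∀ c : F, W.1 * U.1 ≠ c • 1} ∪
        {U | U.1.trace = 2 ∧ (W.1 * U.1).trace = -(2 * e)} := by
    ext U
    have hsq : (W.1 * U.1).trace ^ 2 = 4 ↔
        (W.1 * U.1).trace = 2 * e ∨ (W.1 * U.1).trace = -(2 * e) := by
      rw [← sq_eq_sq_iff_eq_or_eq_neg, mul_pow, he]; norm_num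
    simp only [Set.mem_ofPred_eq, Set.mem_union, hsq]
    constructor
    · rintro ⟨h, h1, h' | h', hs⟩
      · exact .inl ⟨h, h1, h', hs⟩
      · exact .inr ⟨h, h'⟩
    · rintro (⟨h, h1, h', hs⟩ | ⟨h, h'⟩)
      · exact ⟨h, h1, .inl h', hs⟩
      · refine ⟨h, ?_, .inr h', ?_⟩
        · rintro rfl
          apply hne
          rw [← h', ← hWe]
          simp
        · intro c hc
          apply hne
          rw [← h', hc, smul_one_trace, ← hWe, trace_eq_of_mul_eq_smul_one hc, h, mul_comm]
  rw [hsplit, Set.ncard_union_eq, ncard_trace_mul_eq_of_parabolic W e h2 he hWe hns,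
    ncard_trace_mul_eq]
  · rw [hWe]; exact hne
  · rw [Set.disjoint_left]
    rintro U ⟨-, -, h, -⟩ ⟨-, h'⟩
    exact hne (h.symm.trans h')

end

/-- **Deza-graph property of a component of the 1-intersecting graph of `PGL(2,q)`, `q` odd.**
For invertible matrices `M, N` with `det M · det N` a square and distinct induced maps
`f ≠ g`, the number of `h ∈ 𝕄` agreeing with each of `f` and `g` in exactly one point is
`2(q+1)` if `f` and `g` agree nowhere, and `2(q−1)` if they agree in one or two points. -/
theorem stmt_13 (q : ℕ) (hq : Odd q) (hqp : IsPrimePow q)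
    (F : Type) [Field F] [Fintype F] (hF : Fintype.card F = q)
    (M N : GL (Fin 2) F)
    (hdet : IsSquare ((M : Matrix (Fin 2) (Fin 2) F).det * (N : Matrix (Fin 2) (Fin 2) F).det))
    (hfg : indMap M ≠ indMap N)
    (s : ℕ) (hs : s = {x : Projectivization F (Fin 2 → F) | indMap M x = indMap N x}.ncard) :
    (s = 0 →
      {h | h ∈ pglMaps F ∧ (∃! x, h x = indMap M x) ∧ (∃! x, h x = indMap N x)}.ncard
        = 2 * (q + 1)) ∧
    ((s = 1 ∨ s = 2) →
      {h | h ∈ pglMaps F ∧ (∃! x, h x = indMap M x) ∧ (∃! x, h x = indMap N x)}.ncard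
        = 2 * (q - 1)) := by
  have h2 : (2 : F) ≠ 0 := by
    apply Ring.two_ne_zero
    intro h
    have := FiniteField.even_card_iff_char_two.1 h
    rw [hF] at this
    exact Nat.not_odd_iff.2 this hq
  obtain ⟨W, hW⟩ := exists_specialLinear_quotient M N hdet
  have hfix : ∀ x, indMap M x = indMap N x ↔ indMap (W : GL (Fin 2) F) x = x := by
    intro x
    rw [hW, indMap_mul, (indMap_injective N).eq_iff]
  have hns : ∀ c : F, W.1 ≠ c • 1 := by
    intro c hc
    apply hfg
    rw [hW]
    apply indMap_eq_of_smul (c := c)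
    rw [Units.val_mul, SpecialLinearGroup.coe_GL_coe_matrix, hc, Matrix.mul_smul, mul_one]
  have hpar : s = 1 ↔ W.1.trace ^ 2 = 4 := by
    have h1 : s = 1 ↔ ∃! x, indMap (W : GL (Fin 2) F) x = x := by
      simp only [hs, hfix]
      rw [Set.ncard_eq_one]
      exact exists_congr fun a => Set.eq_singleton_iff_unique_mem
    rw [h1, existsUnique_fixed_iff h2, SpecialLinearGroup.coe_GL_coe_matrix,
      W.2, mul_one]
    exact and_iff_left hns
  have hmoved : s + {x | indMap (W : GL (Fin 2) F) x ≠ x}.ncard = q + 1 := by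
    simp only [hs, hfix]
    rw [← hF, ← Nat.card_eq_fintype_card,
      ← Projectivization.card_of_finrank_two F (Fin 2 → F) (by simp)]
    exact Set.ncard_add_ncard_compl _
  have hq2 : 1 < q := hqp.one_lt
  rw [ncard_common_neighbours h2 M N W hW]
  by_cases h1 : s = 1
  · rw [ncard_parabolic_of_trace_sq_eq h2 W (hpar.1 h1) hns, hF]
    obtain ⟨k, rfl⟩ := hq
    lia
  · rw [ncard_parabolic_of_trace_sq_ne h2 W (mt hpar.2 h1)]
    lia
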